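/- Let X be a Polish space, p ≥ 1, and let c : X × X → [0,∞] be a lower semicontinuous cost function such that c(x,x) = 0 for all x and such that c(x,y) = 0 implies x = y. Then for Borel probability measures ν, μ on X, W_p^c(ν,μ) = 0 implies ν = μ. -/

import Mathlib

open MeasureTheory ENNReal

/-- `π` is a coupling of `ν` and `μ`. -/
def IsCoupling {X : Type*} [MeasurableSpace X]
    (π : Measure (X × X)) (ν μ : Measure X) : Prop :=
  π.map Prod.fst = ν ∧ π.map Prod.snd = μ

/-- The optimal transport quantity
`W_p^c(ν,μ) = inf_{π ∈ Π(ν,μ)} (∫ c(x,y)^p dπ(x,y))^(1/p)`. -/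
noncomputable def transportCost {X : Type*} [MeasurableSpace X]
    (c : X → X → ℝ≥0∞) (p : ℝ) (ν μ : Measure X) : ℝ≥0∞ :=
  ⨅ (π : Measure (X × X)) (_ : IsCoupling π ν μ),
    (∫⁻ z, c z.1 z.2 ^ p ∂π) ^ (1 / p)

/-- If the transport cost vanishes, the product of two disjoint compact sets has arbitrarily small
mass under suitable couplings, so their masses sum to at most one. -/
theorem measure_add_measure_le_one_of_disjoint_isCompact
    {X : Type*} [TopologicalSpace X] [PolishSpace X] [MeasurableSpace X] [BorelSpace X]
    {c : X → X → ℝ≥0∞} (hlsc : LowerSemicontinuous (Function.uncurry c))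
    {p : ℝ} (hp : 0 < p) (hsep : ∀ x y, c x y = 0 → x = y)
    {ν μ : Measure X} [IsProbabilityMeasure ν]
    (h : transportCost c p ν μ = 0) {K L : Set X} (hK : IsCompact K) (hL : IsCompact L)
    (hKL : Disjoint K L) : ν K + μ L ≤ 1 := by
  obtain ⟨δ, hδ0, hδt, hδ⟩ : ∃ δ : ℝ≥0∞, 0 < δ ∧ δ < ∞ ∧ ∀ z ∈ K ×ˢ L, δ ≤ c z.1 z.2 := by
    rcases (K ×ˢ L).eq_empty_or_nonempty with he | hne
    · exact ⟨1, one_pos, one_lt_top, by simp [he]⟩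
    obtain ⟨z, hz, hmin⟩ := (hlsc.lowerSemicontinuousOn (K ×ˢ L)).exists_isMinOn hne (hK.prod hL)
    have hpos : 0 < c z.1 z.2 := pos_iff_ne_zero.2 fun h0 ↦
      hKL.ne_of_mem hz.1 hz.2 (hsep _ _ h0)
    obtain ⟨δ, hδ0, hδ⟩ := exists_between hpos
    exact ⟨δ, hδ0, hδ.trans_le le_top, fun w hw ↦ hδ.le.trans (hmin hw)⟩
  have hδp0 : δ ^ p ≠ 0 := (ENNReal.rpow_pos hδ0 hδt.ne).ne'
  have hδpt : δ ^ p ≠ ∞ := (ENNReal.rpow_lt_top_of_nonneg hp.le hδt.ne).ne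
  have hmK := hK.measurableSet
  have hmL := hL.measurableSet
  refine ENNReal.le_of_forall_pos_le_add fun η hη _ ↦ ?_
  have hη' : (η : ℝ≥0∞) ≠ 0 := by simpa using hη.ne'
  have hlt : transportCost c p ν μ < (δ ^ p * η) ^ (1 / p) := by
    rw [h]
    exact ENNReal.rpow_pos (pos_iff_ne_zero.2 (mul_ne_zero hδp0 hη'))
      (ENNReal.mul_ne_top hδpt coe_ne_top)
  simp only [transportCost, iInf_lt_iff] at hlt
  obtain ⟨π, ⟨hfst, hsnd⟩, hπ⟩ := hlt
  rw [ENNReal.rpow_lt_rpow_iff (by positivity)] at hπ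
  have hcharge : π (K ×ˢ L) ≤ η := by
    rw [← ENNReal.mul_le_mul_iff_right hδp0 hδpt]
    calc δ ^ p * π (K ×ˢ L) = ∫⁻ _ in K ×ˢ L, δ ^ p ∂π := (setLIntegral_const _ _).symm
      _ ≤ ∫⁻ z in K ×ˢ L, c z.1 z.2 ^ p ∂π :=
        setLIntegral_mono' (hmK.prod hmL) fun z hz ↦ ENNReal.rpow_le_rpow (hδ z hz) hp.le
      _ ≤ ∫⁻ z, c z.1 z.2 ^ p ∂π := setLIntegral_le_lintegral _ _
      _ ≤ δ ^ p * η := hπ.le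
  have huniv : π Set.univ = 1 := by
    rw [← measure_univ (μ := ν), ← hfst, Measure.map_apply measurable_fst .univ, Set.preimage_univ]
  calc ν K + μ L = π (Prod.fst ⁻¹' K) + π (Prod.snd ⁻¹' L) := by
        rw [← hfst, ← hsnd, Measure.map_apply measurable_fst hmK,
          Measure.map_apply measurable_snd hmL]
    _ = π (Prod.fst ⁻¹' K ∪ Prod.snd ⁻¹' L) + π (K ×ˢ L) :=
        (measure_union_add_inter _ (measurable_snd hmL)).symm
    _ ≤ 1 + η := add_le_add (huniv ▸ measure_mono (Set.subset_univ _)) hcharge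

/-- Let `X` be Polish, `p ≥ 1`, and `c` a lower semicontinuous cost which vanishes exactly
on the diagonal. Then `W_p^c(ν,μ) = 0` implies `ν = μ` for Borel probability measures. -/
theorem wasserstein_eq_zero_implies_eq
    {X : Type*} [TopologicalSpace X] [PolishSpace X] [MeasurableSpace X] [BorelSpace X]
    (c : X → X → ℝ≥0∞) (hlsc : LowerSemicontinuous (Function.uncurry c))
    (p : ℝ) (hp : 1 ≤ p)
    (hdiag : ∀ x, c x x = 0) (hsep : ∀ x y, c x y = 0 → x = y)
    (ν μ : Measure X) [IsProbabilityMeasure ν] [IsProbabilityMeasure μ]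
    (h : transportCost c p ν μ = 0) : ν = μ := by
  refine Measure.eq_of_le_of_isProbabilityMeasure (Measure.le_iff.2 fun A hA ↦ ?_)
  have hsum : ν A + μ Aᶜ ≤ 1 := by
    refine ENNReal.le_of_forall_pos_le_add fun ε hε _ ↦ ?_
    have hε' : (ε : ℝ≥0∞) / 2 ≠ 0 := by simpa using hε.ne'
    obtain ⟨K, hKA, hK, hνK⟩ := hA.exists_isCompact_lt_add (measure_ne_top ν A) hε'
    obtain ⟨L, hLA, hL, hμL⟩ := hA.compl.exists_isCompact_lt_add (measure_ne_top μ Aᶜ) hε'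
    calc ν A + μ Aᶜ ≤ (ν K + ε / 2) + (μ L + ε / 2) := add_le_add hνK.le hμL.le
      _ = (ν K + μ L) + ε := by rw [add_add_add_comm, ENNReal.add_halves]
      _ ≤ 1 + ε := by
        gcongr
        exact measure_add_measure_le_one_of_disjoint_isCompact hlsc (by linarith) hsep h hK hL
          (disjoint_compl_right.mono hKA hLA)
  rw [← prob_add_prob_compl (μ := μ) hA] at hsum
  exact (ENNReal.add_le_add_iff_right (measure_ne_top μ Aᶜ)).1 hsum
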